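/- The series ∑_{n=0}^∞ ((1/2)_n (1/3)_n (2/3)_n)/((1)_n^3) · (2/27)^n equals 3π / (4·Γ(2/3)²·Γ(5/6)²). -/

import Mathlib

open Real

noncomputable def poch (a : ℝ) (n : ℕ) : ℝ := (ascPochhammer ℝ n).eval a

open Filter Topology Finset

lemma poch_zero' (a : ℝ) : poch a 0 = 1 := by simp [poch]

lemma poch_succ' (a : ℝ) (n : ℕ) : poch a (n+1) = poch a n * (a + n) := by
  simp [poch, ascPochhammer_succ_right]

lemma poch_pos' {a : ℝ} (ha : 0 < a) (n : ℕ) : 0 < poch a n := ascPochhammer_pos n a ha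

noncomputable def tt (m n : ℕ) : ℝ :=
  poch (1/6) n * poch (1/3) n / (poch (1 + m) n * poch 1 n)

noncomputable def cg (n : ℕ) : ℝ := tt 0 n

lemma tt_zero (m : ℕ) : tt m 0 = 1 := by simp [tt, poch_zero']

lemma tt_pos (m n : ℕ) : 0 < tt m n := by
  unfold tt
  have h1 := poch_pos' (a := 1/6) (by norm_num) n
  have h2 := poch_pos' (a := 1/3) (by norm_num) n
  have h3 := poch_pos' (a := 1 + m) (by positivity) n
  have h4 := poch_pos' (a := 1) (by norm_num) n
  positivity

lemma tt_succ (m n : ℕ) :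
    tt m (n+1) = tt m n * ((n + 1/6) * (n + 1/3) / ((n + 1 + m) * (n + 1))) := by
  unfold tt
  have h3 := poch_pos' (a := 1 + m) (by positivity) n
  have h4 := poch_pos' (a := 1) (by norm_num) n
  simp only [poch_succ']
  field_simp
  ring

lemma tt_m_succ (m n : ℕ) : tt (m+1) n * (m + 1 + n) = tt m n * (m + 1) := by
  induction n with
  | zero => simp [tt_zero]
  | succ n ih =>
    rw [tt_succ, tt_succ]
    have : tt (m+1) n = tt m n * (m+1) / (m+1+n) := by
      rw [eq_div_iff (by positivity)]; exact ih
    rw [this]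
    push_cast
    field_simp
    ring

lemma tt_anti (m n : ℕ) : tt (m+1) n ≤ tt m n := by
  have h := tt_m_succ m n
  have h1 := tt_pos (m+1) n
  have h2 := tt_pos m n
  have : tt (m+1) n * (m+1) ≤ tt m n * (m+1) := by
    rw [← h]
    exact mul_le_mul_of_nonneg_left (by linarith [(Nat.cast_nonneg n : (0:ℝ) ≤ n)]) h1.le
  exact le_of_mul_le_mul_right this (by positivity)

lemma tt_le (m n : ℕ) : tt m n ≤ tt 0 n := by
  induction m with
  | zero => exact le_rfl
  | succ m ih => exact (tt_anti m n).trans ih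

lemma tt_sq (n : ℕ) : (tt 0 n)^2 * (n+1)^3 ≤ 1 := by
  induction n with
  | zero => simp [tt_zero]
  | succ n ih =>
    rw [tt_succ]
    refine le_trans ?_ ih
    push_cast
    rw [mul_pow, mul_assoc]
    refine mul_le_mul_of_nonneg_left ?_ (sq_nonneg _)
    rw [div_pow, div_mul_eq_mul_div, div_le_iff₀ (by positivity), ← sub_nonneg]
    have h0 : (0:ℝ) ≤ n := Nat.cast_nonneg n
    ring_nf
    positivity

lemma tt_bound (n : ℕ) : tt 0 n ≤ ((n+1 : ℕ) : ℝ) ^ (-(3/2) : ℝ) := by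
  have h := tt_sq n
  have h1 := tt_pos 0 n
  have hp : (0:ℝ) < ((n+1 : ℕ) : ℝ) := by positivity
  refine (pow_le_pow_iff_left₀ h1.le (by positivity) (two_ne_zero)).1 ?_
  rw [← Real.rpow_natCast, ← Real.rpow_natCast (_ ^ _), ← Real.rpow_mul hp.le]
  norm_num
  rw [← one_div, le_div_iff₀ (by positivity)]
  exact h

lemma tt0_summable : Summable (tt 0) := by
  refine Summable.of_nonneg_of_le (fun n => (tt_pos 0 n).le) tt_bound ?_
  exact (summable_nat_add_iff 1).2 (Real.summable_nat_rpow.2 (by norm_num))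

lemma tt_summable (m : ℕ) : Summable (tt m) :=
  Summable.of_nonneg_of_le (fun n => (tt_pos m n).le) (tt_le m) tt0_summable

lemma tt_le_one (n : ℕ) : tt 0 n ≤ 1 := by
  refine (tt_bound n).trans (Real.rpow_le_one_of_one_le_of_nonpos ?_ (by norm_num))
  push_cast; linarith [(Nat.cast_nonneg n : (0:ℝ) ≤ n)]

lemma n_tt_tendsto (m : ℕ) : Tendsto (fun n : ℕ => (n:ℝ) * tt m n) atTop (𝓝 0) := by
  have h : Tendsto (fun n : ℕ => (((n+1:ℕ):ℝ)) ^ (-(1/2):ℝ)) atTop (𝓝 0) :=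
    ((tendsto_rpow_neg_atTop (by norm_num : (0:ℝ) < 1/2)).comp tendsto_natCast_atTop_atTop).comp
      (tendsto_add_atTop_nat 1)
  refine squeeze_zero (fun n => mul_nonneg (Nat.cast_nonneg n) (tt_pos m n).le) (fun n => ?_) h
  have hp : (0:ℝ) < ((n+1 : ℕ) : ℝ) := by positivity
  calc (n:ℝ) * tt m n ≤ ((n+1:ℕ):ℝ) * ((n+1 : ℕ) : ℝ) ^ (-(3/2) : ℝ) := by
        refine mul_le_mul (by push_cast; linarith) ((tt_le m n).trans (tt_bound n)) (tt_pos m n).le hp.le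
    _ = ((n+1:ℕ):ℝ) ^ (-(1/2):ℝ) := by
        nth_rewrite 1 [← Real.rpow_one ((n+1:ℕ):ℝ)]
        rw [← Real.rpow_add hp]; norm_num

noncomputable def FF (m : ℕ) : ℝ := ∑' n, tt m n

lemma FF_step (m : ℕ) : FF m * ((1 + m) * (1/2 + m)) = (5/6 + m) * (2/3 + m) * FF (m+1) := by
  have hs : ∀ N : ℕ, ∑ n ∈ range N, ((1/2 + m) * tt m n - (5/6 + m) * (2/3 + m) / (1 + m) * tt (m+1) n)
      = - ((N:ℝ) * tt m N) := by
    intro N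
    induction N with
    | zero => simp
    | succ N ih =>
      rw [sum_range_succ, ih, tt_succ]
      have : tt (m+1) N = tt m N * (m+1) / (m+1+N) := by
        rw [eq_div_iff (by positivity)]; exact tt_m_succ m N
      rw [this]
      push_cast
      field_simp
      ring
  have h1 : HasSum (fun n => (1/2 + m) * tt m n - (5/6 + m) * (2/3 + m) / (1 + m) * tt (m+1) n)
      ((1/2 + m) * FF m - (5/6 + m) * (2/3 + m) / (1 + m) * FF (m+1)) :=
    ((tt_summable m).hasSum.mul_left _).sub ((tt_summable (m+1)).hasSum.mul_left _)
  have h2 := h1.tendsto_sum_nat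
  simp_rw [hs] at h2
  have h3 := (n_tt_tendsto m).neg
  have h4 := tendsto_nhds_unique h2 h3
  have h5 : (1 + (m:ℝ)) ≠ 0 := by positivity
  field_simp at h4
  linear_combination (1/36) * h4

lemma FF_tendsto : Tendsto FF atTop (𝓝 1) := by
  have h : Tendsto (fun m => ∑' n, tt m n) atTop (𝓝 (∑' n : ℕ, if n = 0 then (1:ℝ) else 0)) := by
    refine tendsto_tsum_of_dominated_convergence tt0_summable ?_ ?_
    · intro n
      rcases n with _ | n
      · simp [tt_zero]
      · simp only [Nat.add_eq_zero_iff, one_ne_zero, and_false, if_false]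
        have hb : ∀ m : ℕ, tt m (n+1) ≤ ((n:ℝ)+1) * (1 / ((m:ℝ)+1)) := by
          intro m
          have : tt m n ≤ 1 := (tt_le m n).trans (tt_le_one n)
          have hp := tt_pos m n
          rw [tt_succ]
          have hn : (0:ℝ) ≤ n := Nat.cast_nonneg n
          have hm : (0:ℝ) ≤ m := Nat.cast_nonneg m
          calc _ ≤ 1 * (((n:ℝ) + 1/6) * (n + 1/3) / ((n + 1 + m) * (n + 1))) := by gcongr
            _ ≤ 1 * (((n:ℝ) + 1) * (n + 1) / ((m + 1) * (n + 1))) := by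
              gcongr ?_ * (?_ * ?_ / (?_ * ?_)) <;> linarith
            _ = _ := by field_simp
        have ht := (tendsto_one_div_add_atTop_nhds_zero_nat (𝕜 := ℝ)).const_mul ((n:ℝ)+1)
        rw [mul_zero] at ht
        exact squeeze_zero (fun m => (tt_pos m (n+1)).le) hb ht
    · filter_upwards with m n
      rw [Real.norm_of_nonneg (tt_pos m n).le]; exact tt_le m n
  rw [tsum_ite_eq] at h
  exact h

lemma FF_prod (m : ℕ) : FF 0 * ((∏ j ∈ range m, (1 + (j:ℝ))) * ∏ j ∈ range m, (1/2 + (j:ℝ))) =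
    (∏ j ∈ range m, (5/6 + (j:ℝ))) * (∏ j ∈ range m, (2/3 + (j:ℝ))) * FF m := by
  induction m with
  | zero => simp
  | succ m ih =>
    simp only [prod_range_succ]
    linear_combination ((1 + (m:ℝ)) * (1/2 + m)) * ih +
      (∏ j ∈ range m, (5/6 + (j:ℝ))) * (∏ j ∈ range m, (2/3 + (j:ℝ))) * FF_step m

lemma gauss : FF 0 * (Real.Gamma (5/6) * Real.Gamma (2/3)) = √π := by
  have h : ∀ᶠ n : ℕ in atTop, Real.GammaSeq 1 n * Real.GammaSeq (1/2) n * FF (n+1) =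
      FF 0 * (Real.GammaSeq (5/6) n * Real.GammaSeq (2/3) n) := by
    filter_upwards [eventually_gt_atTop 0] with n hn
    have hn' : (0:ℝ) < n := by exact_mod_cast hn
    have hp := FF_prod (n+1)
    have e : (n:ℝ)^(5/6:ℝ) * (n:ℝ)^(2/3:ℝ) = (n:ℝ)^(1:ℝ) * (n:ℝ)^(1/2:ℝ) := by
      rw [← Real.rpow_add hn', ← Real.rpow_add hn']; norm_num
    have p1 : (∏ j ∈ range (n+1), (1 + (j:ℝ))) ≠ 0 := (prod_pos fun i _ => by positivity).ne'
    have p2 : (∏ j ∈ range (n+1), (1/2 + (j:ℝ))) ≠ 0 := (prod_pos fun i _ => by positivity).ne'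
    have p3 : (∏ j ∈ range (n+1), (5/6 + (j:ℝ))) ≠ 0 := (prod_pos fun i _ => by positivity).ne'
    have p4 : (∏ j ∈ range (n+1), (2/3 + (j:ℝ))) ≠ 0 := (prod_pos fun i _ => by positivity).ne'
    simp only [Real.GammaSeq]
    set P1 := ∏ j ∈ range (n+1), (1 + (j:ℝ))
    set P2 := ∏ j ∈ range (n+1), (1/2 + (j:ℝ))
    set P3 := ∏ j ∈ range (n+1), (5/6 + (j:ℝ))
    set P4 := ∏ j ∈ range (n+1), (2/3 + (j:ℝ))
    rw [div_mul_div_comm, div_mul_div_comm, div_mul_eq_mul_div, ← mul_div_assoc,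
      div_eq_div_iff (mul_ne_zero p1 p2) (mul_ne_zero p3 p4)]
    set f : ℝ := (n.factorial : ℝ)
    linear_combination (-(n:ℝ)^(1:ℝ) * (n:ℝ)^(1/2:ℝ) * f^2) * hp - FF 0 * f^2 * P1 * P2 * e
  have h1 := ((Real.GammaSeq_tendsto_Gamma 1).mul (Real.GammaSeq_tendsto_Gamma (1/2))).mul
    (FF_tendsto.comp (tendsto_add_atTop_nat 1))
  have h2 := ((Real.GammaSeq_tendsto_Gamma (5/6)).mul (Real.GammaSeq_tendsto_Gamma (2/3))).const_mul (FF 0)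
  have := tendsto_nhds_unique (h1.congr' h) h2
  rw [← this, Real.Gamma_one, Real.Gamma_one_half_eq]; ring


lemma cg_pos (n : ℕ) : 0 < cg n := tt_pos 0 n

noncomputable def ps (c : ℕ → ℝ) (w : ℝ) : ℝ := ∑' n, c n * w ^ n

def dc (c : ℕ → ℝ) (n : ℕ) : ℝ := (n+1) * c (n+1)

def Pol (c : ℕ → ℝ) : Prop := ∃ k : ℕ, ∃ K : ℝ, ∀ n, |c n| ≤ K * ((n:ℝ)+1)^k

lemma pol_dc {c : ℕ → ℝ} (h : Pol c) : Pol (dc c) := by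
  obtain ⟨k, K, hk⟩ := h
  have hK : 0 ≤ K := by
    have := (abs_nonneg _).trans (hk 0)
    simpa using this
  refine ⟨k+1, K * 2^k, fun n => ?_⟩
  have hn : (0:ℝ) ≤ n := Nat.cast_nonneg n
  have h1 := hk (n+1)
  push_cast at h1
  unfold dc
  rw [abs_mul, abs_of_nonneg (by positivity : (0:ℝ) ≤ n + 1)]
  calc ((n:ℝ)+1) * |c (n+1)| ≤ (n+1) * (K * (n + 1 + 1)^k) := by gcongr
    _ ≤ (n+1) * (K * (2 * (n + 1))^k) := by gcongr; linarith
    _ = _ := by rw [mul_pow]; ring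

lemma ps_summable {c : ℕ → ℝ} (h : Pol c) {w : ℝ} (hw : |w| < 1) :
    Summable fun n => c n * w ^ n := by
  obtain ⟨k, K, hk⟩ := h
  obtain ⟨r, h1, h2⟩ := exists_between hw
  have hr : 0 < r := (abs_nonneg w).trans_lt h1
  have hs := (summable_nat_add_iff 1).2
    (summable_pow_mul_geometric_of_norm_lt_one k (r := r) (by rwa [Real.norm_of_nonneg hr.le]))
  refine Summable.of_norm_bounded (hs.mul_left (K * r⁻¹)) fun n => ?_
  rw [Real.norm_eq_abs, abs_mul, abs_pow]
  calc |c n| * |w|^n ≤ (K * ((n:ℝ)+1)^k) * r ^ n :=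
        mul_le_mul (hk n) (pow_le_pow_left₀ (abs_nonneg w) h1.le n) (by positivity)
          ((abs_nonneg _).trans (hk n))
    _ = _ := by push_cast; field_simp; ring

lemma ps_hasDerivAt {c : ℕ → ℝ} (h : Pol c) {w : ℝ} (hw : |w| < 1) :
    HasDerivAt (ps c) (ps (dc c) w) w := by
  obtain ⟨r, h1, h2⟩ := exists_between hw
  have hr : 0 < r := (abs_nonneg w).trans_lt h1
  have hu : Summable (fun n : ℕ => |c n * (n * r^(n-1))|) := by
    rw [← summable_nat_add_iff 1]
    refine ((ps_summable (pol_dc h) (w := r) (by rwa [abs_of_pos hr])).abs).congr fun n => ?_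
    unfold dc
    congr 1
    simp
    ring
  have key := hasDerivAt_tsum_of_isPreconnected (t := Set.Ioo (-r) r) (y₀ := w) (y := w)
    (g := fun n z => c n * z ^ n) (g' := fun n z => c n * (n * z^(n-1))) hu isOpen_Ioo
    isPreconnected_Ioo (fun n y _ => (hasDerivAt_pow n y).const_mul (c n)) ?_ (abs_lt.1 h1)
    (ps_summable h hw) (abs_lt.1 h1)
  · convert! key using 1
    have hs : Summable (fun n : ℕ => c (n+1) * (((n+1 : ℕ):ℝ) * w^(n+1-1))) := by
      refine (ps_summable (pol_dc h) hw).congr fun n => ?_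
      unfold dc
      simp
      ring
    have hs2 : Summable (fun n : ℕ => c n * ((n:ℝ) * w^(n-1))) :=
      (summable_nat_add_iff (f := fun n : ℕ => c n * ((n:ℝ) * w^(n-1))) 1).1 hs
    rw [hs2.tsum_eq_zero_add]
    simp only [ps, dc]
    simp
    exact tsum_congr fun n => by ring
  · intro n y hy
    have := (abs_lt.2 hy).le
    rw [Real.norm_eq_abs, abs_mul, abs_mul, abs_mul, abs_mul, abs_pow, abs_pow, abs_of_pos hr]
    gcongr

lemma cg_pol : Pol cg := ⟨0, 1, fun n => by
  rw [pow_zero, mul_one, cg, abs_of_pos (tt_pos 0 n)]; exact tt_le_one n⟩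

lemma cg_rec (n : ℕ) : ((n:ℝ)+1)^2 * cg (n+1) = (n^2 + n/2 + 1/18) * cg n := by
  unfold cg
  rw [tt_succ]
  push_cast
  field_simp
  ring

lemma ode {w : ℝ} (hw : |w| < 1) :
    w * (1 - w) * ps (dc (dc cg)) w + (1 - 3/2 * w) * ps (dc cg) w - ps cg w / 18 = 0 := by
  have s0 : HasSum _ (ps cg w) := (ps_summable cg_pol hw).hasSum
  have s1 : HasSum _ (ps (dc cg) w) := (ps_summable (pol_dc cg_pol) hw).hasSum
  have s2 : HasSum _ (ps (dc (dc cg)) w) := (ps_summable (pol_dc (pol_dc cg_pol)) hw).hasSum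
  have shift : ∀ (f : ℕ → ℝ) (a : ℝ), f 0 = 0 → HasSum (fun n => f (n+1)) a → HasSum f a := by
    intro f a hf hh
    have := (hasSum_nat_add_iff 1).1 hh
    simpa [hf] using this
  have w1 : HasSum (fun n : ℕ => (n:ℝ) * cg n * w^n) (w * ps (dc cg) w) := by
    apply shift _ _ (by simp)
    refine (s1.mul_left w).congr_fun fun n => ?_
    unfold dc; push_cast; ring
  have w2 : HasSum (fun n : ℕ => (n:ℝ) * dc cg n * w^n) (w * ps (dc (dc cg)) w) := by
    apply shift _ _ (by simp)
    refine (s2.mul_left w).congr_fun fun n => ?_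
    simp only [dc]; push_cast; ring
  have w3 : HasSum (fun n : ℕ => ((n:ℝ) - 1) * n * cg n * w^n) (w * (w * ps (dc (dc cg)) w)) := by
    apply shift _ _ (by simp)
    refine (w2.mul_left w).congr_fun fun n => ?_
    simp only [dc]; push_cast; ring
  have tot := (((w2.sub w3).add s1).sub (w1.mul_left (3/2))).sub (s0.div_const 18)
  have z := tot.unique (hasSum_zero.congr_fun fun n => ?_)
  · linear_combination z
  · have := cg_rec n
    simp only [dc]
    linear_combination (w^n) * this

lemma ps_pos {w : ℝ} (h0 : 0 ≤ w) (h1 : w ≤ 1) : 0 < ps cg w := by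
  have : Summable fun n => cg n * w ^ n := by
    refine Summable.of_nonneg_of_le (fun n => mul_nonneg (cg_pos n).le (by positivity)) (fun n => ?_) tt0_summable
    exact mul_le_of_le_one_right (cg_pos n).le (pow_le_one₀ h0 h1)
  exact this.tsum_pos (fun n => mul_nonneg (cg_pos n).le (by positivity)) 0 (by simp [cg, tt_zero])

lemma ps_cont : ContinuousOn (ps cg) (Set.Icc 0 1) := by
  refine continuousOn_tsum (fun n => by fun_prop) tt0_summable ?_
  intro n w hw
  have h := (cg_pos n).le
  rw [Real.norm_of_nonneg (mul_nonneg h (pow_nonneg hw.1 n))]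
  exact mul_le_of_le_one_right h (pow_le_one₀ hw.1 hw.2)

lemma ps_zero (c : ℕ → ℝ) : ps c 0 = c 0 := by
  unfold ps
  rw [tsum_eq_single 0 (fun n hn => by simp [hn])]; simp

noncomputable def fA (s : ℝ) : ℝ := s * (3 - s)^2 / (1 + s)^3
noncomputable def fB (s : ℝ) : ℝ := s^2 * (3 - s) / 4
noncomputable def dA (s : ℝ) : ℝ := (3 - 9*s) * (3 - s) / (1 + s)^4
noncomputable def dB (s : ℝ) : ℝ := (6*s - 3*s^2) / 4

lemma fA_deriv {s : ℝ} (hs : 0 ≤ s) : HasDerivAt fA (dA s) s := by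
  have h : (1 + s)^3 ≠ 0 := by positivity
  have h1 : (1 + s) ≠ 0 := by positivity
  have := ((hasDerivAt_id s).mul (((hasDerivAt_id s).const_sub 3).pow 2)).div
    (((hasDerivAt_id s).const_add 1).pow 3) h
  convert! this using 1
  simp [dA]
  field_simp
  ring

lemma fB_deriv (s : ℝ) : HasDerivAt fB (dB s) s := by
  have := (((hasDerivAt_id s).pow 2).mul ((hasDerivAt_id s).const_sub 3)).div_const 4
  convert! this using 1
  simp [dB]
  ring

lemma fA_mem {s : ℝ} (h0 : 0 ≤ s) : 0 ≤ fA s ∧ fA s ≤ 1 := by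
  refine ⟨by unfold fA; positivity, ?_⟩
  unfold fA
  rw [div_le_one (by positivity)]
  nlinarith [sq_nonneg (1 - 3*s)]

lemma fA_lt {s : ℝ} (h0 : 0 ≤ s) (h1 : s < 1/3) : |fA s| < 1 := by
  rw [abs_of_nonneg (fA_mem h0).1]
  unfold fA
  rw [div_lt_one (by positivity)]
  nlinarith [sq_pos_of_pos (by linarith : 0 < 1 - 3*s)]

lemma fB_mem {s : ℝ} (h0 : 0 ≤ s) (h1 : s ≤ 1/3) : 0 ≤ fB s ∧ fB s < 1 := by
  have : 0 ≤ 3 - s := by linarith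
  refine ⟨by unfold fB; positivity, ?_⟩
  unfold fB
  nlinarith [mul_nonneg h0 this, sq_nonneg s]

noncomputable def VV (s : ℝ) : ℝ :=
  dA s * ps (dc cg) (fA s) * ps cg (fB s) - ps cg (fA s) * (dB s * ps (dc cg) (fB s))
   - ps cg (fA s) * ps cg (fB s) / (2 * (1 + s))

lemma KK_deriv {s : ℝ} (h0 : 0 ≤ s) (h1 : s < 1/3) :
    HasDerivAt (fun s => s * (3 - s) * VV s) 0 s := by
  have ha := fA_lt h0 h1
  have hb : |fB s| < 1 := by rw [abs_of_nonneg (fB_mem h0 h1.le).1]; exact (fB_mem h0 h1.le).2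
  have h : (1 + s)^4 ≠ 0 := by positivity
  have h' : (1 + s) ≠ 0 := by positivity
  have g0 := (ps_hasDerivAt cg_pol ha).comp s (fA_deriv h0)
  have g1 := (ps_hasDerivAt (pol_dc cg_pol) ha).comp s (fA_deriv h0)
  have k0 := (ps_hasDerivAt cg_pol hb).comp s (fB_deriv s)
  have k1 := (ps_hasDerivAt (pol_dc cg_pol) hb).comp s (fB_deriv s)
  have oa := ode ha
  have ob := ode hb
  have da : HasDerivAt dA ((-9 * (3 - s) - (3 - 9*s)) / (1 + s)^4 - 4 * ((3 - 9*s) * (3 - s)) / (1+s)^5) s := by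
    have := (((((hasDerivAt_id s).const_mul 9).const_sub 3).mul ((hasDerivAt_id s).const_sub 3))).div
      (((hasDerivAt_id s).const_add 1).pow 4) h
    convert! this using 1
    simp
    field_simp
    ring
  have db : HasDerivAt dB ((6 - 6*s)/4) s := by
    have := (((hasDerivAt_id s).const_mul 6).sub (((hasDerivAt_id s).pow 2).const_mul 3)).div_const 4
    convert! this using 1
    simp
    ring
  have hv := ((da.mul g1).mul k0).sub (g0.mul (db.mul k1)) |>.sub
    ((g0.mul k0).div (((hasDerivAt_id s).const_add 1).const_mul 2) (by simpa using h'))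
  have hk := ((hasDerivAt_id s).mul ((hasDerivAt_id s).const_sub 3)).mul hv
  convert! hk using 1
  simp only [Function.comp, id, Pi.mul_apply, Pi.sub_apply, Pi.div_apply]
  generalize ps cg (fA s) = G0 at *
  generalize ps (dc cg) (fA s) = G1 at *
  generalize ps (dc (dc cg)) (fA s) = G2 at *
  generalize ps cg (fB s) = H0 at *
  generalize ps (dc cg) (fB s) = H1 at *
  generalize ps (dc (dc cg)) (fB s) = H2 at *
  clear hk hv g0 g1 k0 k1 da db ha hb
  simp only [fA, fB, dA, dB] at *
  linear_combination (norm := skip) (-(9 * (3 - s) / (1+s)^2 * H0)) * oa + (9 * s / (1+s) * G0) * ob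
  field_simp
  ring

lemma VV_zero {s : ℝ} (h0 : 0 < s) (h1 : s < 1/3) : VV s = 0 := by
  obtain ⟨c, hc, he⟩ := exists_hasDerivAt_eq_slope (fun s => s * (3 - s) * VV s) (fun _ => 0) h0
    (fun x hx => (KK_deriv hx.1 (lt_of_le_of_lt hx.2 h1)).continuousAt.continuousWithinAt)
    (fun x hx => KK_deriv hx.1.le (hx.2.trans h1))
  have h3 : 3 - s ≠ 0 := by linarith
  rw [eq_comm, div_eq_zero_iff] at he
  simpa [h0.ne', h3] using he

lemma transf : ps cg 1 ^ 2 = 4/3 * ps cg (2/27) ^ 2 := by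
  have hBpos : ∀ s : ℝ, 0 ≤ s → s ≤ 1/3 → 0 < ps cg (fB s) := fun s h0 h1 =>
    ps_pos (fB_mem h0 h1).1 (fB_mem h0 h1).2.le
  have hcont : ContinuousOn (fun s => ps cg (fA s) ^ 2 / (ps cg (fB s) ^ 2 * (1 + s))) (Set.Icc 0 (1/3)) := by
    have cA : ContinuousOn fA (Set.Icc 0 (1/3)) := fun x hx =>
      (fA_deriv hx.1).continuousAt.continuousWithinAt
    have cB : ContinuousOn fB (Set.Icc 0 (1/3)) := fun x hx =>
      (fB_deriv x).continuousAt.continuousWithinAt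
    have h1 := ps_cont.comp cA (fun x hx => fA_mem hx.1)
    have h2 := ps_cont.comp cB (fun x hx => ⟨(fB_mem hx.1 hx.2).1, (fB_mem hx.1 hx.2).2.le⟩)
    refine (h1.pow 2).div ((h2.pow 2).mul (by fun_prop)) ?_
    intro x hx
    have := hBpos x hx.1 hx.2
    have hx0 := hx.1
    positivity
  have hder : ∀ x ∈ Set.Ioo (0:ℝ) (1/3), HasDerivAt (fun s => ps cg (fA s) ^ 2 / (ps cg (fB s) ^ 2 * (1 + s))) 0 x := by
    intro x hx
    have hx0 := hx.1
    have hx1 : x < 1/3 := hx.2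
    have hv := VV_zero hx0 hx1
    have hb := fB_mem hx0.le hx1.le
    have g0 := (ps_hasDerivAt cg_pol (fA_lt hx0.le hx1)).comp x (fA_deriv hx0.le)
    have k0 := (ps_hasDerivAt cg_pol (by rw [abs_of_nonneg hb.1]; exact hb.2)).comp x (fB_deriv x)
    have hp := hBpos x hx0.le hx1.le
    have := (g0.pow 2).div ((k0.pow 2).mul ((hasDerivAt_id x).const_add 1))
      (by simp only [Function.comp, Pi.mul_apply, Pi.pow_apply, id]; positivity)
    convert! this using 1
    simp only [Function.comp, Pi.mul_apply, Pi.pow_apply, id]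
    unfold VV at hv
    rw [eq_comm, div_eq_zero_iff]; left
    field_simp at hv
    push_cast
    linear_combination (ps cg (fA x) * ps cg (fB x)) * hv
  obtain ⟨c, hc, he⟩ := exists_hasDerivAt_eq_slope (fun s => ps cg (fA s) ^ 2 / (ps cg (fB s) ^ 2 * (1 + s))) (fun _ => 0)
    (by norm_num : (0:ℝ) < 1/3) hcont hder
  · have a0 : fA 0 = 0 := by norm_num [fA]
    have b0 : fB 0 = 0 := by norm_num [fB]
    have a1 : fA (1/3) = 1 := by norm_num [fA]
    have b1 : fB (1/3) = 2/27 := by norm_num [fB]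
    have c0 : cg 0 = 1 := tt_zero 0
    have hp := hBpos (1/3) (by norm_num) le_rfl
    rw [a0, b0, a1, b1, ps_zero, c0] at he
    rw [b1] at hp
    rw [eq_comm, div_eq_zero_iff] at he
    rcases he with he | he
    · norm_num at he
      field_simp at he
      linarith
    · norm_num at he


noncomputable def sc (n : ℕ) : ℝ := (poch (1/2) n * poch (1/3) n * poch (2/3) n) / (poch 1 n)^3

lemma sc_rec (n : ℕ) : ((n:ℝ)+1)^3 * sc (n+1) = (n + 1/2) * (n + 1/3) * (n + 2/3) * sc n := by
  unfold sc
  have h4 := poch_pos' (a := 1) (by norm_num) n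
  simp only [poch_succ']
  field_simp
  ring

open PowerSeries in
noncomputable def TT (f : PowerSeries ℝ) : PowerSeries ℝ := X * derivative ℝ f

open PowerSeries in
lemma coeff_TT (f : PowerSeries ℝ) (n : ℕ) : coeff n (TT f) = n * coeff n f := by
  unfold TT
  rcases n with _ | n
  · simp
  · rw [coeff_succ_X_mul, coeff_derivative]; push_cast; ring

open PowerSeries in
lemma TT_mul (f g : PowerSeries ℝ) : TT (f * g) = f * TT g + g * TT f := by
  unfold TT
  rw [Derivation.leibniz]
  simp only [smul_eq_mul]; ring

lemma TT_add (f g : PowerSeries ℝ) : TT (f + g) = TT f + TT g := by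
  unfold TT
  rw [map_add]; ring

lemma TT_X : TT PowerSeries.X = PowerSeries.X := by
  ext n
  rw [coeff_TT, PowerSeries.coeff_X]
  split_ifs with h <;> simp [h]

lemma TT_C (c : ℝ) : TT (PowerSeries.C c) = 0 := by
  ext n
  rw [coeff_TT, PowerSeries.coeff_C]
  split_ifs with h <;> simp [h]

open PowerSeries in
lemma clausen_coeff (n : ℕ) : coeff n (mk cg * mk cg) = sc n := by
  set g : PowerSeries ℝ := mk cg with hg
  set y := g * g with hy
  have L : TT (TT g) = X * (TT (TT g) + C (1/2) * TT g + C (1/18) * g) := by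
    ext n
    rcases n with _ | n
    · simp [coeff_TT]
    · rw [coeff_succ_X_mul]
      simp only [map_add, coeff_TT, coeff_C_mul, hg, coeff_mk]
      push_cast
      linear_combination cg_rec n
  have L' := congrArg TT L
  simp only [TT_mul, TT_add, TT_X, TT_C] at L'
  have D : TT (TT (TT y)) = X * (TT (TT (TT y)) + C (3/2) * TT (TT y) + C (13/18) * TT y + C (1/9) * y) := by
    simp only [hy, TT_mul, TT_add]
    have e1 : (C (1/2) : PowerSeries ℝ) = 9 * C (1/18) := by
      rw [← map_ofNat (C (R := ℝ)) 9, ← map_mul]; norm_num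
    have e2 : (C (3/2) : PowerSeries ℝ) = 27 * C (1/18) := by
      rw [← map_ofNat (C (R := ℝ)) 27, ← map_mul]; norm_num
    have e3 : (C (13/18) : PowerSeries ℝ) = 13 * C (1/18) := by
      rw [← map_ofNat (C (R := ℝ)) 13, ← map_mul]; norm_num
    have e4 : (C (1/9) : PowerSeries ℝ) = 2 * C (1/18) := by
      rw [← map_ofNat (C (R := ℝ)) 2, ← map_mul]; norm_num
    have e5 : (1 : PowerSeries ℝ) = 18 * C (1/18) := by
      rw [← map_ofNat (C (R := ℝ)) 18, ← map_mul]; norm_num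
    rw [e1] at L L'
    rw [e2, e3, e4]
    generalize (C (1/18) : PowerSeries ℝ) = q at *
    linear_combination (2 * g) * L' + (6 * TT g) * L + (2 * X * g * TT (TT g)) * e5
  induction n with
  | zero => simp [hy, hg, sc, poch_zero', cg, tt_zero]
  | succ n ih =>
    have h := congrArg (coeff (n+1)) D
    rw [coeff_succ_X_mul] at h
    simp only [map_add, coeff_TT, coeff_C_mul, ih] at h
    have hr := sc_rec n
    push_cast at h
    have hn : ((n:ℝ)+1)^3 ≠ 0 := by positivity
    apply mul_left_cancel₀ hn
    linear_combination h - hr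

lemma clausen {w : ℝ} (h0 : |w| < 1) : ∑' n, sc n * w ^ n = ps cg w ^ 2 := by
  have hs := (ps_summable cg_pol h0).norm
  rw [pow_two, ps, tsum_mul_tsum_eq_tsum_sum_antidiagonal_of_summable_norm hs hs]
  refine tsum_congr fun n => ?_
  rw [← clausen_coeff, PowerSeries.coeff_mul, Finset.sum_mul]
  refine Finset.sum_congr rfl fun p hp => ?_
  rw [Finset.HasAntidiagonal.mem_antidiagonal] at hp
  simp only [PowerSeries.coeff_mk]
  rw [← hp, pow_add]; ring

theorem stmt_15 :
    ∑' n : ℕ, (poch (1/2) n * poch (1/3) n * poch (2/3) n) / (poch 1 n)^3 * ((1:ℝ)) * ((2:ℝ)/27)^n = 3 * π / (4 * (Real.Gamma (2/3))^2 * (Real.Gamma (5/6))^2) := by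
  have h1 : ∑' n : ℕ, (poch (1/2) n * poch (1/3) n * poch (2/3) n) / (poch 1 n)^3 * ((1:ℝ)) * ((2:ℝ)/27)^n
      = ps cg (2/27) ^ 2 := by
    rw [← clausen (by rw [abs_of_pos] <;> norm_num)]
    simp only [sc, mul_one]
  have h2 : ps cg 1 = FF 0 := by simp [ps, FF, cg]
  have h3 := gauss
  have h4 := transf
  have p1 : 0 < Real.Gamma (2/3) := Real.Gamma_pos_of_pos (by norm_num)
  have p2 : 0 < Real.Gamma (5/6) := Real.Gamma_pos_of_pos (by norm_num)
  have h5 : (FF 0 * (Real.Gamma (5/6) * Real.Gamma (2/3)))^2 = π := by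
    rw [h3, Real.sq_sqrt Real.pi_pos.le]
  rw [h1, eq_div_iff (by positivity), ← h5]
  rw [h2] at h4
  linear_combination (-3 * (Real.Gamma (5/6) * Real.Gamma (2/3))^2) * h4
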